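/- arXiv:1711.08345 — 8 statements merged into one kernel-verified Lean document; each statement's English description precedes it below -/
import Mathlib

section
/- Let n ≥ K ≥ 2 be integers, let β be a real number, and let γ : {1,…,n} → ℝ satisfy the occupancy recursion. Then summing the recursion equations yields the exact identity (1 + β(K−1)) · ∑_{t=1}^{n} γ_t = n + β · ∑_{j=1}^{K−1} j · γ_{n−K+1+j}. -/
/-- Summing the occupancy-recursion equations over `t = 1, …, n` yields the exact identity
`(1 + β(K−1)) · ∑_{t=1}^{n} γ_t = n + β · ∑_{j=1}^{K−1} j · γ_{n−K+1+j}`.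
Note: for natural numbers, `t - K + 1 = max 1 (t - K + 1)` thanks to truncated subtraction. -/
theorem sum_occupancy_recursion_identity (n K : ℕ) (hK : 2 ≤ K) (hn : K ≤ n)
    (β : ℝ) (γ : ℕ → ℝ) (hγ1 : γ 1 = 1)
    (hrec : ∀ t, 1 < t → t ≤ n →
      γ t + β * ∑ t' ∈ Finset.Icc (t - K + 1) (t - 1), γ t' = 1) :
    (1 + β * ((K : ℝ) - 1)) * ∑ t ∈ Finset.Icc 1 n, γ t =
      (n : ℝ) + β * ∑ j ∈ Finset.Icc 1 (K - 1), (j : ℝ) * γ (n - K + 1 + j) := by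
  have hsum : ∑ t ∈ Finset.Icc 1 n,
      (γ t + β * ∑ t' ∈ Finset.Icc (t - K + 1) (t - 1), γ t') = (n : ℝ) := by
    have h : ∀ t ∈ Finset.Icc 1 n,
        (γ t + β * ∑ t' ∈ Finset.Icc (t - K + 1) (t - 1), γ t') = (1 : ℝ) := by
      intro t ht
      rw [Finset.mem_Icc] at ht
      rcases Nat.lt_or_ge 1 t with h1 | h1
      · exact hrec t h1 ht.2
      · have : t = 1 := by omega
        subst this
        simp [hγ1]
    rw [Finset.sum_congr rfl h]
    simp
  rw [Finset.sum_add_distrib, ← Finset.mul_sum] at hsum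
  have hD : ∑ t ∈ Finset.Icc 1 n, ∑ t' ∈ Finset.Icc (t - K + 1) (t - 1), γ t'
      = ∑ s ∈ Finset.Icc 1 n, ∑ t ∈ Finset.Icc (s + 1) (min n (s + K - 1)), γ s := by
    apply Finset.sum_comm'
    intro x y
    simp only [Finset.mem_Icc]
    omega
  have hJ : ∑ j ∈ Finset.Icc 1 (K - 1), (j : ℝ) * γ (n - K + 1 + j)
      = ∑ s ∈ Finset.Icc 1 n, ((s - (n - K + 1) : ℕ) : ℝ) * γ s := by
    have hsub : Finset.Icc (n - K + 1 + 1) n ⊆ Finset.Icc 1 n := by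
      intro x
      simp only [Finset.mem_Icc]
      omega
    rw [← Finset.sum_subset hsub]
    · refine Finset.sum_bij (fun j _ => n - K + 1 + j) ?_ ?_ ?_ ?_
      · intro a
        simp only [Finset.mem_Icc]
        omega
      · intro a _ b _ h
        simpa using h
      · intro b hb
        simp only [Finset.mem_Icc] at hb
        exact ⟨b - (n - K + 1), by simp only [Finset.mem_Icc]; omega, by omega⟩
      · intro a _
        simp
    · intro x hx hx'
      simp only [Finset.mem_Icc] at hx hx'
      have : x - (n - K + 1) = 0 := by omega
      simp [this]
  have hT : ((K : ℝ) - 1) * ∑ t ∈ Finset.Icc 1 n, γ t =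
      (∑ t ∈ Finset.Icc 1 n, ∑ t' ∈ Finset.Icc (t - K + 1) (t - 1), γ t')
      + ∑ j ∈ Finset.Icc 1 (K - 1), (j : ℝ) * γ (n - K + 1 + j) := by
    rw [hD, hJ, ← Finset.sum_add_distrib, Finset.mul_sum]
    refine Finset.sum_congr rfl fun s hs => ?_
    rw [Finset.mem_Icc] at hs
    rw [Finset.sum_const, Nat.card_Icc, nsmul_eq_mul, ← add_mul]
    congr 1
    have h : (min n (s + K - 1) + 1 - (s + 1)) + (s - (n - K + 1)) + 1 = K := by omega
    have h2 := congrArg (Nat.cast : ℕ → ℝ) h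
    rw [Nat.cast_add, Nat.cast_add, Nat.cast_one] at h2
    linarith
  linear_combination hsum + β * hT
end

section
/- Let n ≥ K ≥ 2 be integers, let β ∈ [0,1], and let γ : {1,…,n} → [0,1] satisfy the occupancy recursion. Then (1 + β(K−1)) · ∑_{t=1}^{n} γ_t ≤ n + K − 1. -/
/-- For `n ≥ K ≥ 2`, `β ∈ [0,1]`, and `γ : {1,…,n} → [0,1]` satisfying the occupancy
recursion, `(1 + β(K−1)) · ∑_{t=1}^{n} γ_t ≤ n + K − 1`.
Note: for natural numbers, `t - K + 1 = max 1 (t - K + 1)` thanks to truncated subtraction. -/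
theorem sum_occupancy_recursion_le (n K : ℕ) (hK : 2 ≤ K) (hn : K ≤ n)
    (β : ℝ) (hβ0 : 0 ≤ β) (hβ1 : β ≤ 1)
    (γ : ℕ → ℝ) (hγ01 : ∀ t ∈ Finset.Icc 1 n, 0 ≤ γ t ∧ γ t ≤ 1)
    (hγ1 : γ 1 = 1)
    (hrec : ∀ t, 1 < t → t ≤ n →
      γ t + β * ∑ t' ∈ Finset.Icc (t - K + 1) (t - 1), γ t' = 1) :
    (1 + β * ((K : ℝ) - 1)) * ∑ t ∈ Finset.Icc 1 n, γ t ≤ (n : ℝ) + (K : ℝ) - 1 := by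
  classical
  set T : ℕ → ℝ := fun s => ∑ t ∈ (Finset.Icc 1 n).filter (fun t => t < s ∧ s < t + K), γ t
    with hT
  have hTle : ∀ s, 1 ≤ s → s ≤ n → γ s + β * T s = 1 := by
    intro s h1 h2
    rcases Nat.lt_or_ge 1 s with h | h
    · rw [← hrec s h h2]
      have : (Finset.Icc 1 n).filter (fun t => t < s ∧ s < t + K)
          = Finset.Icc (s - K + 1) (s - 1) := by
        ext t
        simp only [Finset.mem_filter, Finset.mem_Icc]
        omega
      simp only [hT, this]
    · have hs : s = 1 := by omega
      subst hs
      have : (Finset.Icc 1 n).filter (fun t => t < 1 ∧ 1 < t + K) = ∅ := by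
        ext t
        simp only [Finset.mem_filter, Finset.mem_Icc, Finset.notMem_empty, iff_false]
        omega
      simp only [hT, this, hγ1]
      simp
  have hTgt : ∀ s, n < s → β * T s ≤ 1 := by
    intro s hs
    have h1 := hTle n (by omega) le_rfl
    have hn0 := hγ01 n (by simp; omega)
    have h2 : T s ≤ γ n + T n := by
      have hnot : n ∉ (Finset.Icc 1 n).filter (fun t => t < n ∧ n < t + K) := by simp
      simp only [hT]
      rw [← Finset.sum_insert hnot]
      apply Finset.sum_le_sum_of_subset_of_nonneg
      · intro t
        simp only [Finset.mem_filter, Finset.mem_Icc, Finset.mem_insert]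
        omega
      · intro t ht _
        apply (hγ01 t _).1
        simp only [Finset.mem_filter, Finset.mem_Icc, Finset.mem_insert] at ht ⊢
        omega
    nlinarith [mul_le_mul_of_nonneg_left h2 hβ0, mul_nonneg (sub_nonneg.2 hβ1) hn0.1]
  have hsum : ∑ s ∈ Finset.Icc 1 (n + (K - 1)), T s
      = ((K : ℝ) - 1) * ∑ t ∈ Finset.Icc 1 n, γ t := by
    simp only [hT, Finset.sum_filter]
    rw [Finset.sum_comm, Finset.mul_sum]
    apply Finset.sum_congr rfl
    intro t ht
    rw [← Finset.sum_filter, Finset.sum_const]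
    have : (Finset.Icc 1 (n + (K - 1))).filter (fun s => t < s ∧ s < t + K)
        = Finset.Ioo t (t + K) := by
      ext s
      simp only [Finset.mem_filter, Finset.mem_Icc, Finset.mem_Ioo] at ht ⊢
      omega
    rw [this, Nat.card_Ioo, nsmul_eq_mul]
    congr 1
    rw [show t + K - t - 1 = K - 1 by omega, Nat.cast_sub (by omega)]
    simp
  have hg : ∑ s ∈ Finset.Icc 1 (n + (K - 1)), (if s ≤ n then γ s else 0)
      = ∑ t ∈ Finset.Icc 1 n, γ t := by
    rw [← Finset.sum_filter]
    congr 1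
    ext s
    simp only [Finset.mem_filter, Finset.mem_Icc]
    omega
  have key : ∑ s ∈ Finset.Icc 1 (n + (K - 1)), ((if s ≤ n then γ s else 0) + β * T s)
      ≤ ∑ s ∈ Finset.Icc 1 (n + (K - 1)), (1 : ℝ) := by
    apply Finset.sum_le_sum
    intro s hs
    rw [Finset.mem_Icc] at hs
    split_ifs with h
    · exact (hTle s hs.1 h).le
    · rw [zero_add]
      exact hTgt s (by omega)
  rw [Finset.sum_add_distrib, ← Finset.mul_sum, hg, hsum] at key
  simp only [Finset.sum_const, Nat.card_Icc, nsmul_eq_mul, mul_one] at key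
  rw [show n + (K - 1) + 1 - 1 = n + (K - 1) by omega, Nat.cast_add,
    Nat.cast_sub (by omega : 1 ≤ K)] at key
  push_cast at key
  linarith
end

section
/- Let n ≥ K ≥ 2 be integers, let β ∈ (0,1], and let γ : {1,…,n} → [0,1] satisfy the occupancy recursion. Then ∑_{t=1}^{n} γ_t ≤ n/(1 + β(K−1)) + 1/β. -/
/-- For `n ≥ K ≥ 2`, `β ∈ (0,1]`, and `γ : {1,…,n} → [0,1]` satisfying the occupancy
recursion, `∑_{t=1}^{n} γ_t ≤ n/(1 + β(K−1)) + 1/β`.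
Note: for natural numbers, `t - K + 1 = max 1 (t - K + 1)` thanks to truncated subtraction. -/
theorem sum_occupancy_recursion_le' (n K : ℕ) (hK : 2 ≤ K) (hn : K ≤ n)
    (β : ℝ) (hβ0 : 0 < β) (hβ1 : β ≤ 1)
    (γ : ℕ → ℝ) (hγ01 : ∀ t ∈ Finset.Icc 1 n, 0 ≤ γ t ∧ γ t ≤ 1)
    (hγ1 : γ 1 = 1)
    (hrec : ∀ t, 1 < t → t ≤ n →
      γ t + β * ∑ t' ∈ Finset.Icc (t - K + 1) (t - 1), γ t' = 1) :
    ∑ t ∈ Finset.Icc 1 n, γ t ≤ (n : ℝ) / (1 + β * ((K : ℝ) - 1)) + 1 / β := by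
  obtain ⟨P, hP⟩ : ∃ P : ℕ → ℝ, ∀ m, P m = ∑ t ∈ Finset.Icc 1 m, γ t := ⟨_, fun _ => rfl⟩
  have hP0 : P 0 = 0 := by simp [hP]
  have hPs : ∀ m, P (m + 1) = P m + γ (m + 1) := by
    intro m
    rw [hP, hP, Finset.sum_Icc_succ_top (by omega)]
  have hwin : ∀ a b, a ≤ b → ∑ t ∈ Finset.Icc (a + 1) b, γ t = P b - P a := by
    intro a b hab
    induction b, hab using Nat.le_induction with
    | base => simp
    | succ b hb ih =>
      rw [Finset.sum_Icc_succ_top (by omega), ih, hPs]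
      ring
  have hr : ∀ m, m < n → γ (m + 1) + β * (P m - P (m + 1 - K)) = 1 := by
    intro m hm
    rcases Nat.eq_zero_or_pos m with rfl | h
    · have : 0 + 1 - K = 0 := by omega
      rw [this]
      simp [hγ1]
    · have h1 := hrec (m + 1) (by omega) (by omega)
      rwa [hwin _ _ (by omega), Nat.add_sub_cancel] at h1
  have hmono : ∀ a b, a ≤ b → b ≤ n → P a ≤ P b := by
    intro a b hab
    induction b, hab using Nat.le_induction with
    | base => intro _; exact le_rfl
    | succ b hb ih =>
      intro hbn
      have h1 := ih (by omega)
      have h2 := (hγ01 (b + 1) (Finset.mem_Icc.2 ⟨by omega, hbn⟩)).1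
      rw [hPs]
      linarith
  obtain ⟨M, rfl⟩ : ∃ M, K = M + 1 := ⟨K - 1, by omega⟩
  have hsum : ∀ m, m ≤ n → P m + β * ∑ i ∈ Finset.range M, P (m - (i + 1)) = m := by
    intro m
    induction m with
    | zero => intro _; simp [hP0]
    | succ m ih =>
      intro hm
      have h1 := ih (by omega)
      have h2 := hr m (by omega)
      have h3 := Finset.sum_range_succ (fun i => P (m - i)) M
      rw [Finset.sum_range_succ' (fun i => P (m - i)) M] at h3
      simp only [Nat.add_sub_add_right, Nat.sub_zero] at h2 h3 ⊢
      rw [hPs]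
      push_cast
      linear_combination h1 + h2 - β * h3
  obtain ⟨k, rfl⟩ : ∃ k, n = k + 1 := ⟨n - 1, by omega⟩
  have htail : β * (P (k + 1) - P (k - M)) ≤ 1 := by
    have h2 := hr k (by omega)
    have h4 := hγ01 (k + 1) (Finset.mem_Icc.2 ⟨by omega, le_rfl⟩)
    simp only [Nat.add_sub_add_right] at h2
    rw [hPs]
    nlinarith [h4.1]
  have hS := hsum (k + 1) le_rfl
  have hlow : ∑ i ∈ Finset.range M, (β * P (k + 1) - 1) ≤
      ∑ i ∈ Finset.range M, β * P (k + 1 - (i + 1)) := by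
    apply Finset.sum_le_sum
    intro i hi
    have hi' := Finset.mem_range.1 hi
    have h5 := mul_le_mul_of_nonneg_left
      (hmono (k - M) (k + 1 - (i + 1)) (by omega) (by omega)) hβ0.le
    linarith
  rw [Finset.sum_const, Finset.card_range, nsmul_eq_mul, ← Finset.mul_sum] at hlow
  rw [← hP]
  have hM : (0 : ℝ) ≤ M := Nat.cast_nonneg M
  have hD : 0 < 1 + β * (M : ℝ) := by positivity
  have hc : ((M + 1 : ℕ) : ℝ) - 1 = M := by push_cast; ring
  rw [hc, ← sub_le_iff_le_add, le_div_iff₀ hD]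
  have h6 : 1 / β * (1 + β * M) = 1 / β + M := by field_simp
  have h7 : 0 < 1 / β := by positivity
  linarith
end

section
/- Let n ≥ K ≥ 2 be integers, let β ∈ [0,1], and let γ : {1,…,n} → [0,1] satisfy the occupancy recursion. Then the expected number of matches H := β · ∑_{t=1}^{n} γ_t satisfies H ≤ nβ/(1 + β(K−1)) + 1. -/
lemma occ_key (n K : ℕ) (hK : 2 ≤ K) (β : ℝ) (γ : ℕ → ℝ)
    (hrec : ∀ t, 1 ≤ t → t ≤ n →
      γ t + β * ∑ t' ∈ Finset.Icc (t - K + 1) (t - 1), γ t' = 1) (m : ℕ) (hm : m ≤ n) :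
    (∑ t ∈ Finset.Icc 1 m, γ t) * (1 + β * ((K : ℝ) - 1)) =
      m + β * ∑ t ∈ Finset.Icc 1 m, γ t * ((K - 1 - (m - t) : ℕ) : ℝ) := by
  induction m with
  | zero => simp
  | succ m ih =>
    have ih := ih (by omega)
    have h := hrec (m + 1) (by omega) hm
    rw [Finset.sum_Icc_succ_top (by omega), Finset.sum_Icc_succ_top (by omega)]
    have hs : ∑ t ∈ Finset.Icc (m + 1 - K + 1) (m + 1 - 1), γ t
        = ∑ t ∈ Finset.Icc 1 m, (if m + 1 - K + 1 ≤ t then γ t else 0) := by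
      rw [← Finset.sum_filter]
      apply Finset.sum_congr _ (fun _ _ => rfl)
      ext t
      simp only [Finset.mem_Icc, Finset.mem_filter]
      omega
    have h2 : ∑ t ∈ Finset.Icc 1 m, γ t * ((K - 1 - (m - t) : ℕ) : ℝ)
        = ∑ t ∈ Finset.Icc 1 m, γ t * ((K - 1 - (m + 1 - t) : ℕ) : ℝ)
          + ∑ t ∈ Finset.Icc (m + 1 - K + 1) (m + 1 - 1), γ t := by
      rw [hs, ← Finset.sum_add_distrib]
      apply Finset.sum_congr rfl
      intro t ht
      rw [Finset.mem_Icc] at ht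
      split_ifs with hc
      · have : K - 1 - (m - t) = K - 1 - (m + 1 - t) + 1 := by omega
        rw [this]
        push_cast
        ring
      · have : K - 1 - (m - t) = K - 1 - (m + 1 - t) := by omega
        rw [this, add_zero]
    have h3 : ((K - 1 - (m + 1 - (m + 1)) : ℕ) : ℝ) = (K : ℝ) - 1 := by
      rw [Nat.sub_self, Nat.sub_zero, Nat.cast_sub (by omega), Nat.cast_one]
    rw [h3, add_mul, ih, h2]
    rw [Nat.cast_succ]
    linear_combination h


/-- For `n ≥ K ≥ 2`, `β ∈ [0,1]`, and `γ : {1,…,n} → [0,1]` satisfying the occupancy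
recursion, the expected number of matches `H = β · ∑_{t=1}^{n} γ_t` satisfies
`H ≤ nβ/(1 + β(K−1)) + 1`.
Note: for natural numbers, `t - K + 1 = max 1 (t - K + 1)` thanks to truncated subtraction. -/
theorem expected_matches_le (n K : ℕ) (hK : 2 ≤ K) (hn : K ≤ n)
    (β : ℝ) (hβ0 : 0 ≤ β) (hβ1 : β ≤ 1)
    (γ : ℕ → ℝ) (hγ01 : ∀ t ∈ Finset.Icc 1 n, 0 ≤ γ t ∧ γ t ≤ 1)
    (hγ1 : γ 1 = 1)
    (hrec : ∀ t, 1 < t → t ≤ n →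
      γ t + β * ∑ t' ∈ Finset.Icc (t - K + 1) (t - 1), γ t' = 1) :
    β * ∑ t ∈ Finset.Icc 1 n, γ t ≤ (n : ℝ) * β / (1 + β * ((K : ℝ) - 1)) + 1 := by
  have hrec' : ∀ t, 1 ≤ t → t ≤ n →
      γ t + β * ∑ t' ∈ Finset.Icc (t - K + 1) (t - 1), γ t' = 1 := by
    intro t h1 h2
    rcases Nat.lt_or_ge 1 t with h | h
    · exact hrec t h h2
    · obtain rfl : t = 1 := by omega
      simp [hγ1]
  have key := occ_key n K hK β γ hrec' n le_rfl
  have hK' : (2 : ℝ) ≤ K := by exact_mod_cast hK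
  have hpos : 0 < 1 + β * ((K : ℝ) - 1) := by nlinarith
  have hlast : β * ∑ t ∈ Finset.Icc (n - K + 1) n, γ t ≤ 1 := by
    have h := hrec n (by omega) le_rfl
    have hn0 := (hγ01 n (Finset.mem_Icc.2 ⟨by omega, le_rfl⟩)).1
    obtain ⟨m, rfl⟩ : ∃ m, n = m + 1 := ⟨n - 1, by omega⟩
    rw [Finset.sum_Icc_succ_top (by omega)]
    rw [Nat.add_sub_cancel] at h
    nlinarith
  have hw : ∑ t ∈ Finset.Icc 1 n, γ t * ((K - 1 - (n - t) : ℕ) : ℝ)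
      ≤ (∑ t ∈ Finset.Icc (n - K + 1) n, γ t) * ((K : ℝ) - 1) := by
    rw [Finset.sum_mul]
    rw [← Finset.sum_subset (s₁ := Finset.Icc (n - K + 1) n)]
    · apply Finset.sum_le_sum
      intro t ht
      rw [Finset.mem_Icc] at ht
      apply mul_le_mul_of_nonneg_left _ (hγ01 t (Finset.mem_Icc.2 ⟨by omega, ht.2⟩)).1
      have : ((K - 1 - (n - t) : ℕ) : ℝ) ≤ ((K - 1 : ℕ) : ℝ) := by
        exact_mod_cast Nat.sub_le _ _
      rwa [Nat.cast_sub (by omega : 1 ≤ K), Nat.cast_one] at this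
    · exact Finset.Icc_subset_Icc (by omega) le_rfl
    · intro t ht ht'
      rw [Finset.mem_Icc] at ht ht'
      have : K - 1 - (n - t) = 0 := by omega
      rw [this]
      simp
  have h1 := mul_le_mul_of_nonneg_left hw hβ0
  have h2 := mul_le_mul_of_nonneg_right hlast (by linarith : 0 ≤ (K : ℝ) - 1)
  have h3 : β * (β * ∑ t ∈ Finset.Icc 1 n, γ t * ((K - 1 - (n - t) : ℕ) : ℝ))
      ≤ β * ((K : ℝ) - 1) := mul_le_mul_of_nonneg_left (by linarith) hβ0
  rw [div_add_one hpos.ne', le_div_iff₀ hpos, mul_assoc, key]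
  linarith
end

section
/- Let K ≥ 1 be an integer and let β_1, …, β_K be nonnegative reals with ∑_{u=1}^{K} β_u ≤ 1. Then ∑_{u=1}^{K} β_u/(1 + β_u (K−1)) ≤ K/(2K − 1), i.e., the sum is at most 1/(2 − 1/K). -/
/-- For an integer `K ≥ 1` and nonnegative reals `β_1, …, β_K` with `∑ β_u ≤ 1`,
`∑_{u=1}^{K} β_u/(1 + β_u(K−1)) ≤ K/(2K − 1)`. -/
theorem sum_g_le_of_card_eq (K : ℕ) (hK : 1 ≤ K) (β : Fin K → ℝ)
    (hβ : ∀ u, 0 ≤ β u) (hsum : ∑ u, β u ≤ 1) :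
    ∑ u, β u / (1 + β u * ((K : ℝ) - 1)) ≤ (K : ℝ) / (2 * (K : ℝ) - 1) := by
  have hk : (1 : ℝ) ≤ K := by exact_mod_cast hK
  have hk0 : (0 : ℝ) ≤ (K : ℝ) - 1 := by linarith
  have hd : (0 : ℝ) < 2 * (K : ℝ) - 1 := by linarith
  have key : ∀ u, β u / (1 + β u * ((K : ℝ) - 1)) ≤
      ((K : ℝ) ^ 2 * β u + ((K : ℝ) - 1)) / (2 * (K : ℝ) - 1) ^ 2 := by
    intro u
    have h1 := mul_nonneg (hβ u) hk0
    rw [div_le_div_iff₀ (by linarith) (by positivity)]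
    have h2 := mul_nonneg hk0 (sq_nonneg ((K : ℝ) * β u - 1))
    linarith
  calc _ ≤ ∑ u, ((K : ℝ) ^ 2 * β u + ((K : ℝ) - 1)) / (2 * (K : ℝ) - 1) ^ 2 :=
        Finset.sum_le_sum fun u _ => key u
    _ = ((K : ℝ) ^ 2 * ∑ u, β u + K * ((K : ℝ) - 1)) / (2 * (K : ℝ) - 1) ^ 2 := by
        rw [← Finset.sum_div, Finset.sum_add_distrib, ← Finset.mul_sum]
        simp
        ring
    _ ≤ ((K : ℝ) * (2 * (K : ℝ) - 1)) / (2 * (K : ℝ) - 1) ^ 2 := by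
        have h3 := mul_le_mul_of_nonneg_left hsum (sq_nonneg (K : ℝ))
        apply div_le_div_of_nonneg_right _ (by positivity)
        linarith
    _ = _ := by
        have := hd.ne'
        rw [pow_two, mul_div_mul_right _ _ this]
end

section
/- Let m ≥ 1 and K ≥ 1 be integers and let β_1, …, β_m be nonnegative reals with ∑_{u=1}^{m} β_u ≤ 1. Then ∑_{u=1}^{m} β_u/(1 + β_u (K−1)) ≤ m/(m + K − 1). -/
/-- For integers `m ≥ 1`, `K ≥ 1` and nonnegative reals `β_1, …, β_m` with `∑ β_u ≤ 1`,
`∑_{u=1}^{m} β_u/(1 + β_u(K−1)) ≤ m/(m + K − 1)`. -/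
theorem sum_g_le (m K : ℕ) (hm : 1 ≤ m) (hK : 1 ≤ K) (β : Fin m → ℝ)
    (hβ : ∀ u, 0 ≤ β u) (hsum : ∑ u, β u ≤ 1) :
    ∑ u, β u / (1 + β u * ((K : ℝ) - 1)) ≤ (m : ℝ) / ((m : ℝ) + (K : ℝ) - 1) := by
  have hm' : (1 : ℝ) ≤ m := by exact_mod_cast hm
  have hK' : (1 : ℝ) ≤ K := by exact_mod_cast hK
  obtain ⟨c, hc⟩ : ∃ c : ℝ, c = (K : ℝ) - 1 := ⟨_, rfl⟩
  have hc0 : 0 ≤ c := by linarith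
  have hd : (m : ℝ) + (K : ℝ) - 1 = m + c := by rw [hc]; ring
  rw [hd, ← hc]
  have hpos : 0 < (m : ℝ) + c := by linarith
  -- tangent line bound at 1/m
  have key : ∀ u, β u / (1 + β u * c) ≤ (c + (m : ℝ) ^ 2 * β u) / ((m : ℝ) + c) ^ 2 := by
    intro u
    have h1 : 0 < 1 + β u * c := by have := mul_nonneg (hβ u) hc0; linarith
    rw [div_le_div_iff₀ h1 (by positivity)]
    have h2 := mul_nonneg hc0 (sq_nonneg (1 - m * β u))
    linarith [show (c + (m : ℝ) ^ 2 * β u) * (1 + β u * c) - β u * ((m : ℝ) + c) ^ 2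
      = c * (1 - m * β u) ^ 2 by ring]
  refine (Finset.sum_le_sum fun u _ => key u).trans ?_
  rw [← Finset.sum_div, Finset.sum_add_distrib, ← Finset.mul_sum]
  simp only [Finset.sum_const, Finset.card_univ, Fintype.card_fin, nsmul_eq_mul]
  rw [div_le_div_iff₀ (by positivity) hpos]
  have h3 : (m : ℝ) * c + (m : ℝ) ^ 2 * ∑ u, β u ≤ m * (m + c) := by
    have := mul_le_mul_of_nonneg_left hsum (sq_nonneg (m : ℝ))
    linarith
  calc _ ≤ (m : ℝ) * (m + c) * (m + c) := mul_le_mul_of_nonneg_right h3 hpos.le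
    _ = _ := by ring
end

section
/- Let n ≥ K ≥ 2 be integers and let U be a finite set with |U| = K. Suppose β : U → [0,1] satisfies ∑_{u ∈ U} β_u ≤ 1, and suppose γ : U × {1,…,n} → [0,1] satisfies, for every u ∈ U, γ_{u,1} = 1 and γ_{u,t} + β_u · ∑_{t' = max(1, t−K+1)}^{t−1} γ_{u,t'} = 1 for all 1 < t ≤ n. Then the objective value ∑_{u ∈ U} ∑_{t=1}^{n} β_u · γ_{u,t} is at most n/(2 − 1/K) + K; equivalently, the objective divided by n is at most 1/(2 − 1/K) + K/n. -/
theorem window_lower (n K : ℕ) (hK : 2 ≤ K) (hn : K ≤ n) (g : ℕ → ℝ)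
    (h01 : ∀ t ∈ Finset.Icc 1 n, 0 ≤ g t ∧ g t ≤ 1) :
    ((K : ℝ) - 1) * (∑ t ∈ Finset.Icc 1 n, g t) - ((K : ℝ) - 1) * ((K : ℝ) - 1) ≤
      ∑ t ∈ Finset.Icc 1 n, ∑ t' ∈ Finset.Icc (t - K + 1) (t - 1), g t' := by
  rw [Finset.sum_comm' (s' := fun y => Finset.Icc (y + 1) (min n (y + K - 1)))
    (t' := Finset.Icc 1 n) (by intro x y; simp only [Finset.mem_Icc]; omega)]
  have hsplit : ∑ t ∈ Finset.Icc 1 n, (((K : ℝ) - 1) * g t -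
      (if n - K + 2 ≤ t then ((K : ℝ) - 1) else 0)) ≤
      ∑ y ∈ Finset.Icc 1 n, ∑ _x ∈ Finset.Icc (y + 1) (min n (y + K - 1)), g y := by
    apply Finset.sum_le_sum
    intro y hy
    have hg := h01 y hy
    have hK' : (2 : ℝ) ≤ K := by exact_mod_cast hK
    rw [Finset.sum_const, nsmul_eq_mul, Nat.card_Icc]
    split_ifs with hc
    · have : (0 : ℝ) ≤ ((min n (y + K - 1) + 1 - (y + 1) : ℕ) : ℝ) * g y :=
        mul_nonneg (Nat.cast_nonneg _) hg.1
      nlinarith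
    · have e : min n (y + K - 1) + 1 - (y + 1) = K - 1 := by omega
      rw [e, Nat.cast_sub (by omega)]
      simp
  have hcnt : ∑ t ∈ Finset.Icc 1 n, (if n - K + 2 ≤ t then ((K : ℝ) - 1) else 0) =
      ((K : ℝ) - 1) * ((K : ℝ) - 1) := by
    rw [← Finset.sum_filter]
    have e : (Finset.Icc 1 n).filter (fun t => n - K + 2 ≤ t) = Finset.Icc (n - K + 2) n := by
      ext t; simp only [Finset.mem_filter, Finset.mem_Icc]; omega
    rw [e, Finset.sum_const, nsmul_eq_mul, Nat.card_Icc]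
    have e2 : n + 1 - (n - K + 2) = K - 1 := by omega
    rw [e2, Nat.cast_sub (by omega)]
    simp
  rw [Finset.sum_sub_distrib, ← Finset.mul_sum, hcnt] at hsplit
  exact hsplit

theorem single_bound (k N b S : ℝ) (hk : 2 ≤ k) (hN : 0 ≤ N) (hb : 0 ≤ b)
    (h : S + b * ((k - 1) * S - (k - 1) * (k - 1)) ≤ N) :
    b * S ≤ N * (1 / (2 * k - 1) + k ^ 2 / (2 * k - 1) ^ 2 * (b - 1 / k)) + k * b := by
  have hd : 0 < 1 + b * (k - 1) := by nlinarith
  have h1 : b * S ≤ N * (b / (1 + b * (k - 1))) + k * b := by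
    have e : N * (b / (1 + b * (k - 1))) + k * b
        = (N * b + k * b * (1 + b * (k - 1))) / (1 + b * (k - 1)) := by
      field_simp
    rw [e, le_div_iff₀ hd]
    have h2 := mul_le_mul_of_nonneg_left h hb
    have h3 : 0 ≤ b * b * (k - 1) := mul_nonneg (mul_nonneg hb hb) (by linarith)
    nlinarith
  have h2k : 0 < 2 * k - 1 := by linarith
  have hk0 : 0 < k := by linarith
  have h2 : b / (1 + b * (k - 1)) ≤ 1 / (2 * k - 1) + k ^ 2 / (2 * k - 1) ^ 2 * (b - 1 / k) := by
    have e : 1 / (2 * k - 1) + k ^ 2 / (2 * k - 1) ^ 2 * (b - 1 / k) - b / (1 + b * (k - 1))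
        = (k - 1) * (k * b - 1) ^ 2 / ((2 * k - 1) ^ 2 * (1 + b * (k - 1))) := by
      have := h2k.ne'
      have := hd.ne'
      field_simp
      ring
    have : 0 ≤ (k - 1) * (k * b - 1) ^ 2 / ((2 * k - 1) ^ 2 * (1 + b * (k - 1))) := by
      have : 0 ≤ k - 1 := by linarith
      positivity
    linarith
  have := mul_le_mul_of_nonneg_left h2 hN
  linarith

/-- Upper bound on the maximization program (3) of the paper: for `n ≥ K ≥ 2`, a set `U`
of `K` offline resources with per-round match probabilities `β : U → [0,1]`,
`∑_u β_u ≤ 1`, and availability probabilities `γ : U × {1,…,n} → [0,1]` satisfying the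
occupancy recursion for each `u`, the objective `∑_u ∑_{t=1}^n β_u γ_{u,t}` is at most
`n/(2 − 1/K) + K`.
Note: for natural numbers, `t - K + 1 = max 1 (t - K + 1)` thanks to truncated subtraction. -/
theorem nonadaptive_objective_le (n K : ℕ) (hK : 2 ≤ K) (hn : K ≤ n)
    {U : Type*} [Fintype U] (hcard : Fintype.card U = K)
    (β : U → ℝ) (hβ0 : ∀ u, 0 ≤ β u) (hβ1 : ∀ u, β u ≤ 1)
    (hsum : ∑ u, β u ≤ 1)
    (γ : U → ℕ → ℝ)
    (hγ01 : ∀ u, ∀ t ∈ Finset.Icc 1 n, 0 ≤ γ u t ∧ γ u t ≤ 1)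
    (hγ1 : ∀ u, γ u 1 = 1)
    (hrec : ∀ u, ∀ t, 1 < t → t ≤ n →
      γ u t + β u * ∑ t' ∈ Finset.Icc (t - K + 1) (t - 1), γ u t' = 1) :
    ∑ u, ∑ t ∈ Finset.Icc 1 n, β u * γ u t ≤ (n : ℝ) / (2 - 1 / (K : ℝ)) + (K : ℝ) := by
  have hK' : (2 : ℝ) ≤ K := by exact_mod_cast hK
  have key : ∀ u, ∑ t ∈ Finset.Icc 1 n, β u * γ u t ≤
      (n : ℝ) * (1 / (2 * K - 1) + (K : ℝ) ^ 2 / (2 * K - 1) ^ 2 * (β u - 1 / K)) + K * β u := by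
    intro u
    rw [← Finset.mul_sum]
    apply single_bound _ _ _ _ hK' (Nat.cast_nonneg n) (hβ0 u)
    have hw := mul_le_mul_of_nonneg_left (window_lower n K hK hn (γ u) (hγ01 u)) (hβ0 u)
    have hs : ∑ t ∈ Finset.Icc 1 n,
        (γ u t + β u * ∑ t' ∈ Finset.Icc (t - K + 1) (t - 1), γ u t') = n := by
      rw [Finset.sum_congr rfl (g := fun _ => (1 : ℝ))]
      · simp
      · intro t ht
        rw [Finset.mem_Icc] at ht
        rcases Nat.lt_or_ge 1 t with h | h
        · exact hrec u t h ht.2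
        · obtain rfl : t = 1 := by omega
          simp [hγ1 u]
    rw [Finset.sum_add_distrib, ← Finset.mul_sum] at hs
    linarith
  refine (Finset.sum_le_sum fun u _ => key u).trans ?_
  rw [Finset.sum_add_distrib, ← Finset.mul_sum, ← Finset.mul_sum, Finset.sum_add_distrib,
    ← Finset.mul_sum, Finset.sum_sub_distrib]
  simp only [Finset.sum_const, Finset.card_univ, hcard, nsmul_eq_mul]
  have hk0 : (K : ℝ) ≠ 0 := by positivity
  have h2k : (0 : ℝ) < 2 * K - 1 := by linarith
  have e : (n : ℝ) / (2 - 1 / K) = n * (K * (1 / (2 * K - 1))) := by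
    have : (2 - 1 / (K : ℝ)) = (2 * K - 1) / K := by field_simp
    rw [this]
    field_simp
  rw [e, mul_one_div_cancel hk0]
  have hneg : (K : ℝ) ^ 2 / (2 * K - 1) ^ 2 * (∑ u, β u - 1) ≤ 0 :=
    mul_nonpos_of_nonneg_of_nonpos (by positivity) (by linarith)
  have h1 := mul_le_mul_of_nonneg_left hneg (Nat.cast_nonneg (α := ℝ) n)
  have h2 := mul_le_mul_of_nonneg_left hsum (by linarith : (0 : ℝ) ≤ K)
  linarith
end

section
/- Let n ≥ 1 and K ≥ 2 be integers and β ∈ [0,1]. Let B_1, …, B_n be independent Bernoulli(β) random variables on a probability space. Define events M_t recursively for t = 1, …, n by M_t = {B_t = 1} ∩ ⋂_{t' = max(1, t−K+1)}^{t−1} M_{t'}^c, and define A_t = ⋂_{t' = max(1, t−K+1)}^{t−1} M_{t'}^c (so A_1 is the whole space). Then for every t ∈ {1,…,n}: (i) P(A_t) + ∑_{t' = max(1, t−K+1)}^{t−1} P(M_{t'}) = 1; and (ii) P(M_t) = β · P(A_t). Consequently, γ_t := P(A_t) satisfies γ_1 = 1 and γ_t + β · ∑_{t' = max(1, t−K+1)}^{t−1}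 γ_{t'} = 1 for all 1 < t ≤ n. -/
open MeasureTheory ProbabilityTheory

/-- A single reusable offline resource over `n` rounds with occupation time `K`: given
independent coin events `C t` with `P(C t) = β` (the events `{B_t = 1}` of independent
Bernoulli(β) random variables), the matched events `M t = C t ∩ ⋂_{t' ∈ window} (M t')ᶜ`
and availability events `A t = ⋂_{t' ∈ window} (M t')ᶜ` (where the window is
`{max(1, t−K+1), …, t−1}`, realized in ℕ by truncated subtraction) satisfy, for all
`t ∈ {1,…,n}`: (i) `P(A t) + ∑_{t' ∈ window} P(M t') = 1`; (ii) `P(M t) = β · P(A t)`.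
Consequently `γ t = P(A t)` satisfies `γ 1 = 1` and the occupancy recursion. -/
theorem availability_satisfies_occupancy_recursion
    {Ω : Type*} [MeasurableSpace Ω] (P : Measure Ω) [IsProbabilityMeasure P]
    (n K : ℕ) (hn : 1 ≤ n) (hK : 2 ≤ K)
    (β : ℝ) (hβ0 : 0 ≤ β) (hβ1 : β ≤ 1)
    (C : ℕ → Set Ω) (hCmeas : ∀ t, MeasurableSet (C t))
    (hCindep : iIndepSet C P)
    (hCprob : ∀ t, P (C t) = ENNReal.ofReal β)
    (M A : ℕ → Set Ω)
    (hM : ∀ t, M t = C t ∩ ⋂ t' ∈ Finset.Icc (t - K + 1) (t - 1), (M t')ᶜ)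
    (hA : ∀ t, A t = ⋂ t' ∈ Finset.Icc (t - K + 1) (t - 1), (M t')ᶜ) :
    (∀ t ∈ Finset.Icc 1 n,
      (P (A t)).toReal + ∑ t' ∈ Finset.Icc (t - K + 1) (t - 1), (P (M t')).toReal = 1) ∧
    (∀ t ∈ Finset.Icc 1 n, (P (M t)).toReal = β * (P (A t)).toReal) ∧
    ((P (A 1)).toReal = 1 ∧
      ∀ t, 1 < t → t ≤ n →
        (P (A t)).toReal +
          β * ∑ t' ∈ Finset.Icc (t - K + 1) (t - 1), (P (A t')).toReal = 1) := by
  have h_le : ∀ i, MeasurableSpace.generateFrom {C i} ≤ (inferInstance : MeasurableSpace Ω) := by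
    intro i
    apply MeasurableSpace.generateFrom_le
    intro u hu
    rw [Set.mem_singleton_iff.mp hu]
    exact hCmeas i
  -- `M s` is determined by the coins up to time `s`
  have hMm : ∀ s t, s < t → MeasurableSet[⨆ i ∈ {i | i < t},
      MeasurableSpace.generateFrom {C i}] (M s) := by
    intro s
    induction s using Nat.strong_induction_on with
    | _ s ih =>
      intro t hst
      rw [hM s]
      refine MeasurableSet.inter ?_ ?_
      · have h1 : MeasurableSpace.generateFrom {C s} ≤ ⨆ i ∈ {i | i < t},
            MeasurableSpace.generateFrom {C i} :=
          le_iSup₂_of_le (f := fun i (_ : i ∈ {i | i < t}) =>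
            MeasurableSpace.generateFrom {C i}) s hst le_rfl
        exact h1 _ (MeasurableSpace.measurableSet_generateFrom rfl)
      · refine Finset.measurableSet_biInter _ ?_
        intro r hr
        rw [Finset.mem_Icc] at hr
        exact (ih r (by omega) t (by omega)).compl
  have hAm : ∀ t, MeasurableSet[⨆ i ∈ {i | i < t},
      MeasurableSpace.generateFrom {C i}] (A t) := by
    intro t
    rw [hA t]
    refine Finset.measurableSet_biInter _ ?_
    intro r hr
    rw [Finset.mem_Icc] at hr
    exact (hMm r t (by omega)).compl
  have hMmeas : ∀ s, MeasurableSet (M s) := fun s =>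
    (iSup₂_le fun i _ => h_le i : (⨆ i ∈ {i | i < s + 1},
      MeasurableSpace.generateFrom {C i}) ≤ _) _ (hMm s (s + 1) (Nat.lt_succ_self s))
  have h2 : ∀ t, (P (M t)).toReal = β * (P (A t)).toReal := by
    intro t
    have hd : Disjoint {i | i < t} ({t} : Set ℕ) := by simp
    have hi := indep_iSup_of_disjoint h_le hCindep hd
    have hCt : MeasurableSet[⨆ i ∈ ({t} : Set ℕ),
        MeasurableSpace.generateFrom {C i}] (C t) := by
      have h1 : MeasurableSpace.generateFrom {C t} ≤ ⨆ i ∈ ({t} : Set ℕ),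
            MeasurableSpace.generateFrom {C i} :=
          le_iSup₂_of_le (f := fun i (_ : i ∈ ({t} : Set ℕ)) =>
            MeasurableSpace.generateFrom {C i}) t rfl le_rfl
      exact h1 _ (MeasurableSpace.measurableSet_generateFrom rfl)
    have h3 := (Indep_iff _ _ P).mp hi _ _ (hAm t) hCt
    rw [hM t, ← hA t, Set.inter_comm, h3, hCprob, ENNReal.toReal_mul,
      ENNReal.toReal_ofReal hβ0, mul_comm]
  have h1 : ∀ t, (P (A t)).toReal +
      ∑ t' ∈ Finset.Icc (t - K + 1) (t - 1), (P (M t')).toReal = 1 := by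
    intro t
    have hlt : ∀ a ∈ Finset.Icc (t - K + 1) (t - 1), ∀ b ∈ Finset.Icc (t - K + 1) (t - 1),
        a < b → Disjoint (M a) (M b) := by
      intro a ha b hb hab
      rw [Finset.mem_Icc] at ha hb
      rw [Set.disjoint_left]
      intro x hxa hxb
      rw [hM b] at hxb
      have := Set.mem_iInter₂.mp hxb.2 a (Finset.mem_Icc.mpr ⟨by omega, by omega⟩)
      exact this hxa
    have hdis : Set.PairwiseDisjoint (↑(Finset.Icc (t - K + 1) (t - 1))) M := by
      intro a ha b hb hab
      rcases lt_or_gt_of_ne hab with h | h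
      · exact hlt a ha b hb h
      · exact (hlt b hb a ha h).symm
    have hU := measureReal_biUnion_finset (μ := P) hdis (fun b _ => hMmeas b)
    have hc : A t = (⋃ b ∈ Finset.Icc (t - K + 1) (t - 1), M b)ᶜ := by
      rw [hA t]; simp only [Set.compl_iUnion]
    have hcm := probReal_compl_eq_one_sub (μ := P)
      (Finset.measurableSet_biUnion (Finset.Icc (t - K + 1) (t - 1)) (fun b _ => hMmeas b))
    rw [← hc, hU] at hcm
    simp only [Measure.real] at hcm
    linarith
  refine ⟨fun t _ => h1 t, fun t _ => h2 t, ?_, ?_⟩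
  · have := h1 1
    rw [Finset.Icc_eq_empty (by omega)] at this
    simpa using this
  · intro t _ _
    rw [Finset.mul_sum, ← h1 t]
    congr 1
    exact Finset.sum_congr rfl fun s _ => (h2 s).symm
end
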